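/- Let p : [0,1) → ℝ be integrable, fix n ∈ ℕ, n ≥ 1, ξ ∈ [0,1), and let k* ∈ {1,…,2^n} be the index with ξ ∈ I_n(k*). Write p̃_n = S_{2^n}p. Then det(I + (Ĵ^ξ)^⊤P) = Π_{i=0}^{k*−2} (1 − p̃_n(i/2^n)/2^{n+1}) · (1 + ((2k*−1)/2^{n+1} − ξ) · p̃_n((k*−1)/2^n)) · Π_{j=k*}^{2^n−1} (1 + p̃_n(j/2^n)/2^{n+1}), where I is the 2^n × 2^n identity matrix. -/

import Mathlib

open MeasureTheory Matrix

/-- The `k`-th binary digit of `x ∈ [0,1)`, using the expansion terminating in zeros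
for dyadic rationals. -/
noncomputable def binDigit (k : ℕ) (x : ℝ) : ℕ := ⌊x * 2 ^ (k + 1)⌋.toNat % 2

/-- Rademacher functions `r_k(x) = (-1)^{x_k}`. -/
noncomputable def rademacher (k : ℕ) (x : ℝ) : ℝ := (-1 : ℝ) ^ binDigit k x

/-- Walsh–Paley functions `ω_n(x) = ∏_k r_k(x)^{n_k}`. -/
noncomputable def walsh (n : ℕ) (x : ℝ) : ℝ :=
  ∏ k ∈ Finset.range n, if n.testBit k then rademacher k x else 1

/-- Walsh–Fourier coefficient `f̂_k = ∫₀¹ f ω_k`. -/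
noncomputable def fcoef (f : ℝ → ℝ) (k : ℕ) : ℝ := ∫ x in (0:ℝ)..1, f x * walsh k x

/-- The `2^n`-th partial sum of the Walsh–Fourier series:
`S_{2^n} f (x) = ∑_{k<2^n} f̂_k ω_k(x)`. -/
noncomputable def S2 (n : ℕ) (f : ℝ → ℝ) (x : ℝ) : ℝ :=
  ∑ k ∈ Finset.range (2 ^ n), fcoef f k * walsh k x

/-- The Hadamard matrix `W` of size `2^n × 2^n` with entries `W_{ij} = ω_j(i/2^n)`. -/
noncomputable def Wmat (n : ℕ) : Matrix (Fin (2 ^ n)) (Fin (2 ^ n)) ℝ :=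
  fun i j => walsh j.1 ((i.1 : ℝ) / 2 ^ n)

/-- The matrix `Ĵ^ξ` with entries `(Ĵ^ξ)_{k,j} = ∫₀¹ J_k^ξ(x) ω_j(x) dx`, where
`J_k^ξ(x) = ∫_ξ^x ω_k(t) dt`. -/
noncomputable def Jhat (n : ℕ) (ξ : ℝ) : Matrix (Fin (2 ^ n)) (Fin (2 ^ n)) ℝ :=
  fun k j => ∫ x in (0:ℝ)..1, (∫ t in ξ..x, walsh k.1 t) * walsh j.1 x

/-- The dyadic circulant matrix `P` with entries `P_{ij} = p̂_{i ⊕ j}`. -/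
noncomputable def Pmat (n : ℕ) (p : ℝ → ℝ) : Matrix (Fin (2 ^ n)) (Fin (2 ^ n)) ℝ :=
  fun i j => fcoef p (i.1 ^^^ j.1)

/-- A matrix that is block triangular for an injective index function has determinant equal to
the product of its diagonal entries. -/
lemma Matrix.BlockTriangular.det_of_injective {ι : Type*} [Fintype ι] [DecidableEq ι]
    {M : Matrix ι ι ℝ} {b : ι → ℕ} (hM : M.BlockTriangular b) (hb : Function.Injective b) :
    M.det = ∏ i, M i i := by
  let _ : LinearOrder ι := LinearOrder.lift' b hb
  have h : M.BlockTriangular id := fun i j hij => hM hij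
  convert Matrix.det_of_isUpperTriangular h

lemma binDigit_of_floor {n k m : ℕ} (hk : k < n) {x : ℝ} (hm : ⌊x * 2 ^ n⌋₊ = m) :
    binDigit k x = m / 2 ^ (n - 1 - k) % 2 := by
  unfold binDigit
  rw [Int.floor_toNat]
  congr 1
  rw [← hm, ← Nat.floor_div_natCast]
  congr 1
  have : n = (k + 1) + (n - 1 - k) := by omega
  push_cast
  rw [eq_div_iff (by positivity), mul_assoc, ← pow_add, ← this]

lemma floor_of_mem {n m : ℕ} {x : ℝ}
    (hx : x ∈ Set.Ico ((m : ℝ) / 2 ^ n) (((m : ℝ) + 1) / 2 ^ n)) : ⌊x * 2 ^ n⌋₊ = m := by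
  obtain ⟨h1, h2⟩ := hx
  rw [div_le_iff₀ (by positivity)] at h1
  rw [lt_div_iff₀ (by positivity)] at h2
  rw [Nat.floor_eq_iff (le_trans (by positivity) h1)]
  exact ⟨h1, h2⟩

lemma floor_node (n m : ℕ) : ⌊(m : ℝ) / 2 ^ n * 2 ^ n⌋₊ = m := by
  rw [div_mul_cancel₀ _ (by positivity), Nat.floor_natCast]

lemma walsh_eq_prod_range {n k : ℕ} (hk : k < 2 ^ n) (x : ℝ) :
    walsh k x = ∏ i ∈ Finset.range n, if k.testBit i then rademacher i x else 1 := by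
  unfold walsh
  rw [← Finset.prod_filter, ← Finset.prod_filter]
  refine Finset.prod_congr ?_ fun _ _ => rfl
  ext i
  simp only [Finset.mem_filter, Finset.mem_range, and_congr_left_iff]
  intro hi
  have h1 := Nat.ge_two_pow_of_testBit hi
  have h2 : i < 2 ^ i := Nat.lt_two_pow_self
  have h3 : i < n := (Nat.pow_lt_pow_iff_right (by norm_num : 1 < 2)).1 (lt_of_le_of_lt h1 hk)
  exact ⟨fun _ => h3, fun _ => by omega⟩

lemma walsh_eq_node {n k m : ℕ} (hk : k < 2 ^ n) {x : ℝ}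
    (hx : x ∈ Set.Ico ((m : ℝ) / 2 ^ n) (((m : ℝ) + 1) / 2 ^ n)) :
    walsh k x = walsh k ((m : ℝ) / 2 ^ n) := by
  rw [walsh_eq_prod_range hk, walsh_eq_prod_range hk]
  refine Finset.prod_congr rfl fun i hi => ?_
  have hi := Finset.mem_range.1 hi
  unfold rademacher
  rw [binDigit_of_floor hi (floor_of_mem hx), binDigit_of_floor hi (floor_node n m)]

lemma rademacher_mul_self (k : ℕ) (x : ℝ) : rademacher k x * rademacher k x = 1 := by
  unfold rademacher
  rw [← mul_pow]
  norm_num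

lemma walsh_xor {n k l : ℕ} (hk : k < 2 ^ n) (hl : l < 2 ^ n) (x : ℝ) :
    walsh (k ^^^ l) x = walsh k x * walsh l x := by
  rw [walsh_eq_prod_range hk, walsh_eq_prod_range hl,
    walsh_eq_prod_range (Nat.xor_lt_two_pow hk hl), ← Finset.prod_mul_distrib]
  refine Finset.prod_congr rfl fun i _ => ?_
  rw [Nat.testBit_xor]
  cases k.testBit i <;> cases l.testBit i <;> simp [rademacher_mul_self]

lemma sum_prod_testBit (n : ℕ) (a : ℕ → ℝ) :
    ∑ j ∈ Finset.range (2 ^ n), ∏ k ∈ Finset.range n, (if j.testBit k then a k else 1) =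
      ∏ k ∈ Finset.range n, (1 + a k) := by
  induction n with
  | zero => simp
  | succ n ih =>
    rw [pow_succ, mul_two, Finset.sum_range_add, Finset.prod_range_succ, mul_add, mul_one, ← ih,
      Finset.sum_mul]
    congr 1
    · refine Finset.sum_congr rfl fun j hj => ?_
      rw [Finset.prod_range_succ, Nat.testBit_lt_two_pow (Finset.mem_range.1 hj)]
      simp
    · refine Finset.sum_congr rfl fun j hj => ?_
      rw [Finset.prod_range_succ, Nat.testBit_two_pow_add_eq,
        Nat.testBit_lt_two_pow (Finset.mem_range.1 hj)]
      simp only [Bool.not_false, if_true]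
      congr 1
      refine Finset.prod_congr rfl fun k hk => ?_
      rw [Nat.testBit_two_pow_add_gt (Finset.mem_range.1 hk)]

lemma Wmat_mul_transpose (n : ℕ) : Wmat n * (Wmat n)ᵀ = (2 ^ n : ℝ) • 1 := by
  ext i i'
  rw [Matrix.mul_apply]
  have h : ∀ j : Fin (2 ^ n), Wmat n i j * (Wmat n)ᵀ j i' =
      ∏ k ∈ Finset.range n, (if j.1.testBit k then
        rademacher k ((i.1 : ℝ) / 2 ^ n) * rademacher k ((i'.1 : ℝ) / 2 ^ n) else 1) := by
    intro j
    rw [Matrix.transpose_apply, Wmat, Wmat, walsh_eq_prod_range j.2, walsh_eq_prod_range j.2,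
      ← Finset.prod_mul_distrib]
    refine Finset.prod_congr rfl fun k _ => ?_
    split_ifs <;> simp
  rw [Finset.sum_congr rfl fun j _ => h j,
    Fin.sum_univ_eq_sum_range (fun j => ∏ k ∈ Finset.range n, (if j.testBit k then
        rademacher k ((i.1 : ℝ) / 2 ^ n) * rademacher k ((i'.1 : ℝ) / 2 ^ n) else 1)),
    sum_prod_testBit]
  by_cases hii : i = i'
  · subst hii
    simp [rademacher_mul_self]
    norm_num
  · rw [Matrix.smul_apply, Matrix.one_apply_ne hii, smul_zero]
    obtain ⟨k, hk⟩ := Nat.exists_testBit_ne_of_ne (fun h => hii (Fin.ext h))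
    have hkn : k < n := by
      by_contra! hn
      have h2 : 2 ^ n ≤ 2 ^ k := Nat.pow_le_pow_right (by norm_num) hn
      rw [Nat.testBit_lt_two_pow (i.2.trans_le h2), Nat.testBit_lt_two_pow (i'.2.trans_le h2)] at hk
      exact hk rfl
    refine Finset.prod_eq_zero (i := n - 1 - k) (Finset.mem_range.2 (by omega)) ?_
    unfold rademacher
    rw [binDigit_of_floor (by omega) (floor_node n i), binDigit_of_floor (by omega) (floor_node n i'),
      show n - 1 - (n - 1 - k) = k by omega]
    rw [Nat.testBit_eq_decide_div_mod_eq, Nat.testBit_eq_decide_div_mod_eq] at hk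
    rcases Nat.mod_two_eq_zero_or_one (i.1 / 2 ^ k) with h1 | h1 <;>
    rcases Nat.mod_two_eq_zero_or_one (i'.1 / 2 ^ k) with h2 | h2 <;>
    simp [h1, h2] at hk ⊢

lemma Wmat_mul_Pmat (n : ℕ) (p : ℝ → ℝ) :
    Wmat n * Pmat n p =
      Matrix.diagonal (fun i : Fin (2 ^ n) => S2 n p ((i.1 : ℝ) / 2 ^ n)) * Wmat n := by
  ext i j
  rw [Matrix.diagonal_mul, Matrix.mul_apply, S2, Finset.sum_mul]
  have h : ∀ l : Fin (2 ^ n), Wmat n i l * Pmat n p l j =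
      (fun l => walsh l ((i.1 : ℝ) / 2 ^ n) * fcoef p (l ^^^ j.1)) l.1 := fun l => rfl
  rw [Finset.sum_congr rfl fun l _ => h l,
    Fin.sum_univ_eq_sum_range (fun l => walsh l ((i.1 : ℝ) / 2 ^ n) * fcoef p (l ^^^ j.1))]
  refine Finset.sum_nbij' (· ^^^ j.1) (· ^^^ j.1) ?_ ?_ ?_ ?_ ?_
  · exact fun l hl => Finset.mem_range.2 (Nat.xor_lt_two_pow (Finset.mem_range.1 hl) j.2)
  · exact fun l hl => Finset.mem_range.2 (Nat.xor_lt_two_pow (Finset.mem_range.1 hl) j.2)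
  · exact fun l _ => Nat.xor_xor_cancel_right l j
  · exact fun l _ => Nat.xor_xor_cancel_right l j
  · intro l hl
    have hl := Finset.mem_range.1 hl
    rw [walsh_xor hl j.2, Wmat]
    have hsq : walsh j.1 ((i.1 : ℝ) / 2 ^ n) * walsh j.1 ((i.1 : ℝ) / 2 ^ n) = 1 := by
      rw [← walsh_xor j.2 j.2, Nat.xor_self]
      simp [walsh]
    linear_combination (-walsh l ((i.1 : ℝ) / 2 ^ n) * fcoef p (l ^^^ j.1)) * hsq

/-- The projection of `x` to `[m / 2 ^ n, (m + 1) / 2 ^ n]`, a primitive of the indicator of that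
interval. -/
noncomputable def dyadicClamp (n m : ℕ) (x : ℝ) : ℝ :=
  max ((m : ℝ) / 2 ^ n) (min (((m : ℝ) + 1) / 2 ^ n) x)

lemma node_le_succ (n m : ℕ) : (m : ℝ) / 2 ^ n ≤ ((m : ℝ) + 1) / 2 ^ n := by
  gcongr
  linarith

lemma node_le_node {m l : ℕ} (n : ℕ) (h : m + 1 ≤ l) : ((m : ℝ) + 1) / 2 ^ n ≤ (l : ℝ) / 2 ^ n := by
  gcongr
  exact_mod_cast h

lemma dyadicClamp_of_le {n m : ℕ} {x : ℝ} (h : x ≤ (m : ℝ) / 2 ^ n) :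
    dyadicClamp n m x = (m : ℝ) / 2 ^ n :=
  max_eq_left ((min_le_right _ _).trans h)

lemma dyadicClamp_of_ge {n m : ℕ} {x : ℝ} (h : ((m : ℝ) + 1) / 2 ^ n ≤ x) :
    dyadicClamp n m x = ((m : ℝ) + 1) / 2 ^ n := by
  rw [dyadicClamp, min_eq_left h, max_eq_right (node_le_succ n m)]

lemma dyadicClamp_of_mem {n m : ℕ} {x : ℝ}
    (h : x ∈ Set.Icc ((m : ℝ) / 2 ^ n) (((m : ℝ) + 1) / 2 ^ n)) : dyadicClamp n m x = x := by
  rw [dyadicClamp, min_eq_right h.2, max_eq_right h.1]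

lemma continuous_dyadicClamp (n m : ℕ) : Continuous (dyadicClamp n m) := by
  unfold dyadicClamp
  fun_prop

lemma intervalIntegrable_indicator_Ico (a b u v : ℝ) :
    IntervalIntegrable (Set.indicator (Set.Ico a b) fun _ => (1 : ℝ)) volume u v := by
  rw [intervalIntegrable_iff]
  exact (integrableOn_const (by simp) (by simp)).indicator measurableSet_Ico

lemma integral_indicator_Ico_of_le {n m : ℕ} {u v : ℝ} (huv : u ≤ v) :
    ∫ t in u..v, Set.indicator (Set.Ico ((m : ℝ) / 2 ^ n) (((m : ℝ) + 1) / 2 ^ n))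
      (fun _ => (1 : ℝ)) t = dyadicClamp n m v - dyadicClamp n m u := by
  have hab := node_le_succ n m
  unfold dyadicClamp
  set a := (m : ℝ) / 2 ^ n
  set b := ((m : ℝ) + 1) / 2 ^ n
  rw [intervalIntegral.integral_of_le huv, ← integral_Ico_eq_integral_Ioc,
    setIntegral_indicator measurableSet_Ico, Set.Ico_inter_Ico]
  simp only [integral_const, smul_eq_mul, mul_one, MeasurableSet.univ, measureReal_restrict_apply,
    Set.univ_inter, Real.volume_real_Ico]
  grind

lemma integral_indicator_Ico (n m : ℕ) (u v : ℝ) :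
    ∫ t in u..v, Set.indicator (Set.Ico ((m : ℝ) / 2 ^ n) (((m : ℝ) + 1) / 2 ^ n))
      (fun _ => (1 : ℝ)) t = dyadicClamp n m v - dyadicClamp n m u := by
  rcases le_total u v with h | h
  · exact integral_indicator_Ico_of_le h
  · rw [intervalIntegral.integral_symm, integral_indicator_Ico_of_le h, neg_sub]

lemma walsh_eq_sum_indicator {n k : ℕ} (hk : k < 2 ^ n) {x : ℝ} (hx : x ∈ Set.Ico (0 : ℝ) 1) :
    walsh k x = ∑ m : Fin (2 ^ n), walsh k ((m.1 : ℝ) / 2 ^ n) *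
      Set.indicator (Set.Ico ((m.1 : ℝ) / 2 ^ n) (((m.1 : ℝ) + 1) / 2 ^ n))
        (fun _ => (1 : ℝ)) x := by
  have hx0 : 0 ≤ x * 2 ^ n := mul_nonneg hx.1 (by positivity)
  have hlt : ⌊x * 2 ^ n⌋₊ < 2 ^ n := by
    rw [Nat.floor_lt hx0]
    push_cast
    exact mul_lt_of_lt_one_left (by positivity) hx.2
  have hmem : x ∈ Set.Ico ((⌊x * 2 ^ n⌋₊ : ℝ) / 2 ^ n) (((⌊x * 2 ^ n⌋₊ : ℝ) + 1) / 2 ^ n) := by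
    constructor
    · rw [div_le_iff₀ (by positivity)]
      exact Nat.floor_le hx0
    · rw [lt_div_iff₀ (by positivity)]
      exact Nat.lt_floor_add_one _
  rw [Finset.sum_eq_single ⟨_, hlt⟩]
  · rw [Set.indicator_of_mem hmem, mul_one, walsh_eq_node hk hmem]
  · intro m _ hm
    rw [Set.indicator_of_notMem, mul_zero]
    exact fun h => hm (Fin.ext (floor_of_mem h).symm)
  · simp

lemma integral_walsh {n k : ℕ} (hk : k < 2 ^ n) {ξ x : ℝ} (hξ : ξ ∈ Set.Ico (0 : ℝ) 1)
    (hx : x ∈ Set.Ico (0 : ℝ) 1) :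
    ∫ t in ξ..x, walsh k t = ∑ m : Fin (2 ^ n), walsh k ((m.1 : ℝ) / 2 ^ n) *
      (dyadicClamp n m x - dyadicClamp n m ξ) := by
  have hsub : Set.uIcc ξ x ⊆ Set.Ico (0 : ℝ) 1 := Set.OrdConnected.uIcc_subset inferInstance hξ hx
  rw [intervalIntegral.integral_congr fun t ht => walsh_eq_sum_indicator hk (hsub ht),
    intervalIntegral.integral_finsetSum
      fun m _ => (intervalIntegrable_indicator_Ico _ _ _ _).const_mul _]
  refine Finset.sum_congr rfl fun m _ => ?_
  rw [intervalIntegral.integral_const_mul, integral_indicator_Ico]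

/-- The integrals of the triangular functions of the dyadic interval indicators over the dyadic
intervals. -/
noncomputable def clampMat (n : ℕ) (ξ : ℝ) : Matrix (Fin (2 ^ n)) (Fin (2 ^ n)) ℝ :=
  fun m l => ∫ x in ((l.1 : ℝ) / 2 ^ n)..(((l.1 : ℝ) + 1) / 2 ^ n),
    (dyadicClamp n m x - dyadicClamp n m ξ)

lemma integral_mul_walsh {n k : ℕ} (hk : k < 2 ^ n) {f g : ℝ → ℝ} (hf : Continuous f)
    (hfg : ∀ x ∈ Set.Ico (0 : ℝ) 1, g x = f x) :
    ∫ x in (0 : ℝ)..1, g x * walsh k x = ∑ l : Fin (2 ^ n),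
      (∫ x in ((l.1 : ℝ) / 2 ^ n)..(((l.1 : ℝ) + 1) / 2 ^ n), f x) *
        walsh k ((l.1 : ℝ) / 2 ^ n) := by
  have hpiece : ∀ l : ℕ, l < 2 ^ n → ∀ x ∈ Set.Ioo ((l : ℝ) / 2 ^ n) (((l : ℝ) + 1) / 2 ^ n),
      f x * walsh k ((l : ℝ) / 2 ^ n) = g x * walsh k x := by
    intro l hl x hx
    rw [walsh_eq_node hk ⟨hx.1.le, hx.2⟩, hfg]
    refine ⟨le_trans (by positivity) hx.1.le, hx.2.trans_le ?_⟩
    rw [div_le_one (by positivity)]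
    exact_mod_cast hl
  have hint : ∀ l : ℕ, l < 2 ^ n → IntervalIntegrable (fun x => g x * walsh k x) volume
      ((l : ℝ) / 2 ^ n) (((l + 1 : ℕ) : ℝ) / 2 ^ n) := by
    intro l hl
    push_cast
    have hc : IntervalIntegrable (fun x => f x * walsh k ((l : ℝ) / 2 ^ n)) volume
      ((l : ℝ) / 2 ^ n) (((l : ℝ) + 1) / 2 ^ n) :=
      (hf.mul continuous_const).intervalIntegrable _ _
    rw [intervalIntegrable_iff_integrableOn_Ioo_of_le (node_le_succ n l)] at hc ⊢
    exact hc.congr_fun (hpiece l hl) measurableSet_Ioo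
  have hsum := intervalIntegral.sum_integral_adjacent_intervals (a := fun l : ℕ => (l : ℝ) / 2 ^ n)
    hint
  have h1 : ((2 ^ n : ℕ) : ℝ) / 2 ^ n = 1 := by
    push_cast
    exact div_self (by positivity)
  rw [h1, Nat.cast_zero, zero_div] at hsum
  rw [← hsum, ← Fin.sum_univ_eq_sum_range]
  refine Finset.sum_congr rfl fun l _ => ?_
  push_cast
  rw [← intervalIntegral.integral_mul_const, intervalIntegral.integral_of_le (node_le_succ n l),
    intervalIntegral.integral_of_le (node_le_succ n l), integral_Ioc_eq_integral_Ioo,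
    integral_Ioc_eq_integral_Ioo]
  exact (setIntegral_congr_fun measurableSet_Ioo (hpiece l l.2)).symm

lemma Jhat_eq {n : ℕ} {ξ : ℝ} (hξ : ξ ∈ Set.Ico (0 : ℝ) 1) :
    Jhat n ξ = (Wmat n)ᵀ * clampMat n ξ * Wmat n := by
  ext k j
  have hc : ∀ m : ℕ, Continuous fun x =>
      walsh k.1 ((m : ℝ) / 2 ^ n) * (dyadicClamp n m x - dyadicClamp n m ξ) :=
    fun m => continuous_const.mul ((continuous_dyadicClamp n m).sub continuous_const)
  rw [Jhat, integral_mul_walsh j.2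
    (continuous_finsetSum _ fun (m : Fin (2 ^ n)) _ => hc m)
    (fun x hx => integral_walsh k.2 hξ hx), Matrix.mul_apply]
  refine Finset.sum_congr rfl fun l _ => ?_
  rw [Matrix.mul_apply, Wmat]
  congr 1
  rw [intervalIntegral.integral_finsetSum
    fun (m : Fin (2 ^ n)) _ => (hc m).intervalIntegrable _ _]
  refine Finset.sum_congr rfl fun m _ => ?_
  rw [intervalIntegral.integral_const_mul]
  rfl

lemma det_one_add_Jhat_transpose_mul_Pmat {n : ℕ} (p : ℝ → ℝ) {ξ : ℝ}
    (hξ : ξ ∈ Set.Ico (0 : ℝ) 1) :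
    Matrix.det (1 + (Jhat n ξ)ᵀ * Pmat n p) = Matrix.det (1 + (2 ^ n : ℝ) • ((clampMat n ξ)ᵀ *
      Matrix.diagonal (fun i : Fin (2 ^ n) => S2 n p ((i.1 : ℝ) / 2 ^ n)))) := by
  have h : (Jhat n ξ)ᵀ * Pmat n p = (Wmat n)ᵀ * ((clampMat n ξ)ᵀ *
      Matrix.diagonal (fun i : Fin (2 ^ n) => S2 n p ((i.1 : ℝ) / 2 ^ n)) * Wmat n) := by
    rw [Jhat_eq hξ, Matrix.transpose_mul, Matrix.transpose_mul, Matrix.transpose_transpose]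
    simp only [Matrix.mul_assoc, Wmat_mul_Pmat]
  rw [h, Matrix.det_one_add_mul_comm, Matrix.mul_assoc _ (Wmat n), Wmat_mul_transpose,
    Matrix.mul_smul, Matrix.mul_one]

section clampMat

variable {n c : ℕ} {ξ : ℝ}

lemma clampMat_eq_integral {m l : Fin (2 ^ n)} {f : ℝ → ℝ}
    (h : ∀ x ∈ Set.Icc ((l.1 : ℝ) / 2 ^ n) (((l.1 : ℝ) + 1) / 2 ^ n),
      dyadicClamp n m x - dyadicClamp n m ξ = f x) :
    clampMat n ξ m l = ∫ x in ((l.1 : ℝ) / 2 ^ n)..(((l.1 : ℝ) + 1) / 2 ^ n), f x := by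
  refine intervalIntegral.integral_congr fun x hx => ?_
  rw [Set.uIcc_of_le (node_le_succ n l)] at hx
  exact h x hx

lemma clampMat_eq_zero_of_lt (hξ2 : ξ < ((c : ℝ) + 1) / 2 ^ n) {m l : Fin (2 ^ n)}
    (hm : c < m.1) (hl : l.1 < m.1) : clampMat n ξ m l = 0 := by
  rw [clampMat_eq_integral (f := fun _ => 0), intervalIntegral.integral_zero]
  intro x hx
  rw [dyadicClamp_of_le (hx.2.trans (node_le_node n hl)),
    dyadicClamp_of_le (hξ2.le.trans (node_le_node n hm)), sub_self]

lemma clampMat_eq_zero_of_gt (hξ1 : (c : ℝ) / 2 ^ n ≤ ξ) {m l : Fin (2 ^ n)}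
    (hm : m.1 < c) (hl : m.1 < l.1) : clampMat n ξ m l = 0 := by
  rw [clampMat_eq_integral (f := fun _ => 0), intervalIntegral.integral_zero]
  intro x hx
  rw [dyadicClamp_of_ge ((node_le_node n hl).trans hx.1),
    dyadicClamp_of_ge ((node_le_node n hm).trans hξ1), sub_self]

lemma clampMat_diag_of_eq_sub {m : Fin (2 ^ n)} {d : ℝ} (hd : dyadicClamp n m ξ = d) :
    clampMat n ξ m m = ((2 * (m.1 : ℝ) + 1) / 2 ^ (n + 1) - d) / 2 ^ n := by
  rw [clampMat_eq_integral (f := fun x => x - d)]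
  · rw [intervalIntegral.integral_sub (by simp) (by simp), integral_id,
      intervalIntegral.integral_const, smul_eq_mul]
    field_simp
    ring
  · intro x hx
    rw [dyadicClamp_of_mem hx, hd]

lemma clampMat_diag_of_gt (hξ2 : ξ < ((c : ℝ) + 1) / 2 ^ n) {m : Fin (2 ^ n)} (hm : c < m.1) :
    2 ^ n * clampMat n ξ m m = 1 / 2 ^ (n + 1) := by
  rw [clampMat_diag_of_eq_sub (dyadicClamp_of_le (hξ2.le.trans (node_le_node n hm)))]
  field_simp
  ring

lemma clampMat_diag_of_lt (hξ1 : (c : ℝ) / 2 ^ n ≤ ξ) {m : Fin (2 ^ n)} (hm : m.1 < c) :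
    2 ^ n * clampMat n ξ m m = -(1 / 2 ^ (n + 1)) := by
  rw [clampMat_diag_of_eq_sub (dyadicClamp_of_ge ((node_le_node n hm).trans hξ1))]
  field_simp
  ring

lemma clampMat_diag_of_eq (hξ1 : (c : ℝ) / 2 ^ n ≤ ξ) (hξ2 : ξ < ((c : ℝ) + 1) / 2 ^ n)
    {m : Fin (2 ^ n)} (hm : m.1 = c) :
    2 ^ n * clampMat n ξ m m = (2 * (c : ℝ) + 1) / 2 ^ (n + 1) - ξ := by
  subst hm
  rw [clampMat_diag_of_eq_sub (dyadicClamp_of_mem ⟨hξ1, hξ2.le⟩)]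
  field_simp

lemma det_one_add_clampMat (hξ1 : (c : ℝ) / 2 ^ n ≤ ξ) (hξ2 : ξ < ((c : ℝ) + 1) / 2 ^ n)
    (d : Fin (2 ^ n) → ℝ) :
    Matrix.det (1 + (2 ^ n : ℝ) • ((clampMat n ξ)ᵀ * Matrix.diagonal d)) =
      ∏ i, (1 + 2 ^ n * clampMat n ξ i i * d i) := by
  rw [Matrix.BlockTriangular.det_of_injective
    (b := fun l => if l.1 < c then l.1 else if l.1 = c then 3 * 2 ^ n else 2 * 2 ^ n - l.1)]
  · refine Finset.prod_congr rfl fun i _ => ?_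
    simp [mul_assoc]
  · intro l m hlm
    have hne : l ≠ m := by
      rintro rfl
      exact lt_irrefl _ hlm
    have hl := l.2
    have hm := m.2
    have hne' : l.1 ≠ m.1 := fun h => hne (Fin.ext h)
    dsimp only at hlm
    have h0 : clampMat n ξ m l = 0 := by
      rcases lt_trichotomy m.1 c with h | h | h
      · refine clampMat_eq_zero_of_gt hξ1 h ?_
        split_ifs at hlm <;> omega
      · split_ifs at hlm <;> omega
      · refine clampMat_eq_zero_of_lt hξ2 h ?_
        split_ifs at hlm <;> omega
    simp [Matrix.one_apply_ne hne, h0]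
  · intro l m hlm
    have hl := l.2
    have hm := m.2
    dsimp only at hlm
    ext
    split_ifs at hlm <;> omega

end clampMat

/-- The determinant of `I + (Ĵ^ξ)ᵀ P` as a product, where `ξ ∈ I_n(k*)`. -/
theorem det_identity_add_Jhat_transpose_P (p : ℝ → ℝ)
    (hpi : IntegrableOn p (Set.Ico (0:ℝ) 1))
    (n : ℕ) (hn : 1 ≤ n) (ξ : ℝ) (hξ : ξ ∈ Set.Ico (0:ℝ) 1)
    (kstar : ℕ) (hk1 : 1 ≤ kstar) (hk2 : kstar ≤ 2 ^ n)
    (hξ1 : ((kstar : ℝ) - 1) / 2 ^ n ≤ ξ) (hξ2 : ξ < (kstar : ℝ) / 2 ^ n) :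
    Matrix.det (1 + (Jhat n ξ)ᵀ * Pmat n p) =
      (∏ i ∈ Finset.range (kstar - 1), (1 - S2 n p ((i : ℝ) / 2 ^ n) / 2 ^ (n + 1))) *
        (1 + ((2 * (kstar : ℝ) - 1) / 2 ^ (n + 1) - ξ) *
          S2 n p (((kstar : ℝ) - 1) / 2 ^ n)) *
        (∏ j ∈ Finset.Ico kstar (2 ^ n), (1 + S2 n p ((j : ℝ) / 2 ^ n) / 2 ^ (n + 1))) := by
  obtain ⟨c, rfl⟩ : ∃ c, kstar = c + 1 := ⟨kstar - 1, by omega⟩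
  push_cast at hξ1 hξ2 ⊢
  rw [add_sub_cancel_right] at hξ1
  rw [det_one_add_Jhat_transpose_mul_Pmat p hξ, det_one_add_clampMat hξ1 hξ2]
  obtain ⟨f, hf⟩ : ∃ f : ℕ → ℝ, ∀ i, f i = 1 + (if i < c then -(1 / 2 ^ (n + 1)) else
      if i = c then (2 * (c : ℝ) + 1) / 2 ^ (n + 1) - ξ else 1 / 2 ^ (n + 1)) *
        S2 n p ((i : ℝ) / 2 ^ n) := ⟨_, fun _ => rfl⟩
  have hdiag : ∀ i : Fin (2 ^ n),
      1 + 2 ^ n * clampMat n ξ i i * S2 n p ((i.1 : ℝ) / 2 ^ n) = f i.1 := by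
    intro i
    rw [hf]
    rcases lt_trichotomy i.1 c with h | h | h
    · rw [if_pos h, clampMat_diag_of_lt hξ1 h]
    · rw [if_neg h.not_lt, if_pos h, clampMat_diag_of_eq hξ1 hξ2 h]
    · rw [if_neg h.not_gt, if_neg h.ne', clampMat_diag_of_gt hξ2 h]
  rw [Finset.prod_congr rfl fun i _ => hdiag i, Fin.prod_univ_eq_prod_range,
    ← Finset.prod_range_mul_prod_Ico _ hk2, Finset.prod_range_succ, add_tsub_cancel_right]
  congr 1
  · congr 1
    · refine Finset.prod_congr rfl fun i hi => ?_
      rw [hf, if_pos (Finset.mem_range.1 hi)]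
      ring
    · rw [hf, if_neg (lt_irrefl c), if_pos rfl]
      ring
  · refine Finset.prod_congr rfl fun i hi => ?_
    have hi := (Finset.mem_Ico.1 hi).1
    rw [hf, if_neg (by omega), if_neg (by omega)]
    ring
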